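/- Let Ω ⊆ ℝ^n be a compact convex set with diameter D > 0, let x ∈ Ω lie in a set F ⊆ Ω, let S ⊆ F, and let g ∈ ℝ^n with ‖π(T_Ω(x), g)‖ > 0. Let s maximize ⟨g, ·⟩ over Ω, let x_F minimize ⟨g, ·⟩ over F, let q ∈ S, and let PW > 0 be such that ⟨g, s − q⟩ ≥ PW · ⟨g, e/‖e‖⟩ for every e ∈ (Ω − x) \ {0} with ⟨g, e⟩ > 0. Let d ∈ {s − x, x − x_F} satisfy ⟨g, d⟩ = max(⟨g, s − x⟩, ⟨g, x − x_F⟩) and d ≠ 0, and suppose ‖d‖ ≤ 2D. Then ⟨g, d⟩ / (‖π(T_Ω(x), g)‖ · ‖d‖) ≥ PW / (2D). -/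

import Mathlib

open Set Metric RealInnerProductSpace

noncomputable section

/-- The tangent cone to a convex set `Ω` at `x`: the closure of the cone of feasible
directions. -/
def tangentCone {n : ℕ} (Ω : Set (EuclideanSpace ℝ (Fin n))) (x : EuclideanSpace ℝ (Fin n)) :
    Set (EuclideanSpace ℝ (Fin n)) :=
  closure {w | ∃ l : ℝ, 0 < l ∧ x + l • w ∈ Ω}

/-- The normal cone to a convex set `Ω` at `x`. -/
def normalCone {n : ℕ} (Ω : Set (EuclideanSpace ℝ (Fin n))) (x : EuclideanSpace ℝ (Fin n)) :
    Set (EuclideanSpace ℝ (Fin n)) :=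
  {v | ∀ y ∈ Ω, ⟪v, y - x⟫ ≤ 0}

/-- `p` is the Euclidean (metric) projection of `g` onto the set `C`. -/
def IsProjection {n : ℕ} (C : Set (EuclideanSpace ℝ (Fin n)))
    (g p : EuclideanSpace ℝ (Fin n)) : Prop :=
  p ∈ C ∧ ∀ w ∈ C, ‖g - p‖ ≤ ‖g - w‖

/-- The tangent cone is closed under positive scaling. -/
theorem smul_mem_tangentCone {n : ℕ} {Ω : Set (EuclideanSpace ℝ (Fin n))}
    {x w : EuclideanSpace ℝ (Fin n)} (hw : w ∈ tangentCone Ω x) {t : ℝ} (ht : 0 < t) :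
    t • w ∈ tangentCone Ω x := by
  refine map_mem_closure (continuous_const_smul t) hw ?_
  rintro v ⟨l, hl, hv⟩
  refine ⟨l / t, by positivity, ?_⟩
  rwa [smul_smul, div_mul_cancel₀ _ ht.ne']

/-- The projection `p` of `g` onto a tangent cone satisfies `‖p‖ ^ 2 ≤ ⟪g, p⟫`. -/
theorem IsProjection.sq_norm_le_inner {n : ℕ} {Ω : Set (EuclideanSpace ℝ (Fin n))}
    {x g p : EuclideanSpace ℝ (Fin n)} (hp : IsProjection (tangentCone Ω x) g p) :
    ‖p‖ ^ 2 ≤ ⟪g, p⟫ := by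
  have key : ∀ t : ℝ, 0 < t → t < 1 → (1 + t) * ‖p‖ ^ 2 ≤ 2 * ⟪g, p⟫ := by
    intro t ht0 ht1
    have h := hp.2 _ (smul_mem_tangentCone hp.1 ht0)
    have h2 := pow_le_pow_left₀ (norm_nonneg _) h 2
    rw [norm_sub_sq_real, norm_sub_sq_real, inner_smul_right, norm_smul, mul_pow,
      Real.norm_eq_abs, sq_abs] at h2
    refine le_of_mul_le_mul_left ?_ (sub_pos.2 ht1)
    linarith
  by_contra! hlt
  have hP : 0 < ‖p‖ ^ 2 := by
    rcases (sq_nonneg ‖p‖).eq_or_lt with h0 | h0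
    · have : p = 0 := by simpa using h0.symm
      simp [this] at hlt
    · exact h0
  have h := key (max (1 / 2) (⟪g, p⟫ / ‖p‖ ^ 2)) (by positivity)
    (max_lt (by norm_num) ((div_lt_one hP).2 hlt))
  have h' := (div_le_iff₀ hP).1 (le_max_right (1 / 2) (⟪g, p⟫ / ‖p‖ ^ 2))
  linarith

/-- A bound on the slope of `g` along feasible directions extends to the tangent cone. -/
theorem mul_inner_le_of_mem_tangentCone {n : ℕ} {Ω : Set (EuclideanSpace ℝ (Fin n))}
    {x g w : EuclideanSpace ℝ (Fin n)} {c A : ℝ} (hc : 0 ≤ c) (hA : 0 ≤ A)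
    (hslope : ∀ e : EuclideanSpace ℝ (Fin n), (∃ h ∈ Ω, e = h - x) → e ≠ 0 →
      0 < ⟪g, e⟫ → c * ⟪g, ‖e‖⁻¹ • e⟫ ≤ A) (hw : w ∈ tangentCone Ω x) :
    c * ⟪g, w⟫ ≤ A * ‖w‖ := by
  have hcl : IsClosed {v : EuclideanSpace ℝ (Fin n) | c * ⟪g, v⟫ ≤ A * ‖v‖} :=
    isClosed_le (by fun_prop) (by fun_prop)
  refine closure_minimal ?_ hcl hw
  rintro v ⟨l, hl, hv⟩
  change c * ⟪g, v⟫ ≤ A * ‖v‖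
  rcases le_or_gt ⟪g, v⟫ 0 with h0 | h0
  · exact (mul_nonpos_of_nonneg_of_nonpos hc h0).trans (by positivity)
  · have hv0 : v ≠ 0 := by
      rintro rfl
      simp at h0
    have hn : 0 < ‖v‖ := norm_pos_iff.2 hv0
    have h := hslope (l • v) ⟨_, hv, by simp⟩ (smul_ne_zero hl.ne' hv0)
      (by rw [inner_smul_right]; positivity)
    rw [norm_smul, Real.norm_of_nonneg hl.le, smul_smul, inner_smul_right,
      show (l * ‖v‖)⁻¹ * l = ‖v‖⁻¹ by field_simp] at h
    calc c * ⟪g, v⟫ = c * (‖v‖⁻¹ * ⟪g, v⟫) * ‖v‖ := by field_simp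
      _ ≤ A * ‖v‖ := by gcongr

/-- the FDFW direction `d ∈ {s - x, x - x_F}` (Frank-Wolfe direction or
in-face direction), selected with maximal slope, has normalized slope at least
`PW / (2D)`, given the pyramidal width inequality for the pairwise direction `s - q`
with `q` in an active set `S ⊆ F`. -/
theorem stmt6 {n : ℕ} (Ω : Set (EuclideanSpace ℝ (Fin n)))
    (hΩcp : IsCompact Ω) (hΩconv : Convex ℝ Ω)
    (D : ℝ) (hD : D = Metric.diam Ω) (hDpos : 0 < D)
    (F S : Set (EuclideanSpace ℝ (Fin n))) (hFΩ : F ⊆ Ω) (hSF : S ⊆ F)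
    (x : EuclideanSpace ℝ (Fin n)) (hxΩ : x ∈ Ω) (hxF : x ∈ F)
    (g p : EuclideanSpace ℝ (Fin n))
    (hp : IsProjection (tangentCone Ω x) g p) (hppos : 0 < ‖p‖)
    (s : EuclideanSpace ℝ (Fin n)) (hs : s ∈ Ω) (hsmax : ∀ z ∈ Ω, ⟪g, z⟫ ≤ ⟪g, s⟫)
    (xF : EuclideanSpace ℝ (Fin n)) (hxFmem : xF ∈ F) (hxFmin : ∀ z ∈ F, ⟪g, xF⟫ ≤ ⟪g, z⟫)
    (q : EuclideanSpace ℝ (Fin n)) (hq : q ∈ S)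
    (PW : ℝ) (hPW : 0 < PW)
    (hslope : ∀ e : EuclideanSpace ℝ (Fin n), (∃ h ∈ Ω, e = h - x) → e ≠ 0 →
      0 < ⟪g, e⟫ → PW * ⟪g, ‖e‖⁻¹ • e⟫ ≤ ⟪g, s - q⟫)
    (d : EuclideanSpace ℝ (Fin n))
    (hdmem : d = s - x ∨ d = x - xF)
    (hdmax : ⟪g, d⟫ = max ⟪g, s - x⟫ ⟪g, x - xF⟫)
    (hd0 : d ≠ 0) (hd2D : ‖d‖ ≤ 2 * D) :
    PW / (2 * D) ≤ ⟪g, d⟫ / (‖p‖ * ‖d‖) := by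
  have hA : 0 ≤ ⟪g, s - q⟫ := by
    rw [inner_sub_right]
    linarith [hsmax q (hFΩ (hSF hq))]
  have h1 := mul_inner_le_of_mem_tangentCone hPW.le hA hslope hp.1
  have h2 : PW * ‖p‖ ≤ ⟪g, s - q⟫ := by
    refine le_of_mul_le_mul_right ?_ hppos
    calc PW * ‖p‖ * ‖p‖ = PW * ‖p‖ ^ 2 := by ring
      _ ≤ PW * ⟪g, p⟫ := by gcongr; exact hp.sq_norm_le_inner
      _ ≤ _ := h1
  have h3 : ⟪g, s - q⟫ ≤ 2 * ⟪g, d⟫ := by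
    have ha := hdmax ▸ le_max_left ⟪g, s - x⟫ ⟪g, x - xF⟫
    have hb := hdmax ▸ le_max_right ⟪g, s - x⟫ ⟪g, x - xF⟫
    simp only [inner_sub_right] at ha hb ⊢
    linarith [hxFmin q (hSF hq)]
  have h4 : ‖d‖ ≤ D := by
    rw [hD]
    rcases hdmem with rfl | rfl <;> rw [← dist_eq_norm]
    · exact dist_le_diam_of_mem hΩcp.isBounded hs hxΩ
    · exact dist_le_diam_of_mem hΩcp.isBounded hxΩ (hFΩ hxFmem)
  have hd : 0 < ‖d‖ := norm_pos_iff.2 hd0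
  rw [div_le_div_iff₀ (by positivity) (by positivity)]
  calc PW * (‖p‖ * ‖d‖) = PW * ‖p‖ * ‖d‖ := by ring
    _ ≤ 2 * ⟪g, d⟫ * D := mul_le_mul (h2.trans h3) h4 hd.le (hA.trans h3)
    _ = ⟪g, d⟫ * (2 * D) := by ring
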